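/- Every fixed point of a K-expansive flow on a compact metric space is an isolated point of the space. -/

import Mathlib

theorem stmt4 {X : Type*} [MetricSpace X] [CompactSpace X]
    (φ : ℝ → X → X)
    (hcont : Continuous fun p : ℝ × X => φ p.1 p.2)
    (h0 : ∀ x, φ 0 x = x)
    (hadd : ∀ t s x, φ (t + s) x = φ t (φ s x))
    (hK : ∀ ε > (0:ℝ), ∃ δ > (0:ℝ), ∀ (x y : X) (s : ℝ → ℝ),
      StrictMono s → Function.Surjective s → s 0 = 0 →
      (∀ t, dist (φ t x) (φ (s t) y) < δ) →
      ∃ τ : ℝ, |τ| < ε ∧ y = φ τ x) :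
    ∀ x : X, (∀ t, φ t x = x) → IsOpen ({x} : Set X) := by
  intro p hp
  obtain ⟨δ, hδ, H⟩ := hK 1 one_pos
  -- points whose orbit stays close to `p` on the window `[-4, 4]`
  have hU : ∀ᶠ x in nhds p, ∀ t ∈ Set.Icc (-4:ℝ) 4, dist (φ t x) p < δ / 2 := by
    apply isCompact_Icc.eventually_forall_of_forall_eventually
    intro t _
    have hc : Continuous fun z : X × ℝ => dist (φ z.2 z.1) p :=
      (hcont.comp (continuous_snd.prodMk continuous_fst)).dist continuous_const
    apply hc.continuousAt.eventually_lt continuousAt_const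
    simp only [hp, dist_self]
    linarith
  have key : ∀ᶠ x in nhds p, x = p := by
    filter_upwards [hU] with x hx
    let r : ℝ → ℝ := fun t => t + max 0 (2 - |t| / 2)
    have hr : ∀ t, r t = t + max 0 (2 - |t| / 2) := fun _ => rfl
    have hmono : StrictMono r := by
      intro a b hab
      rw [hr, hr]
      have h1 : |b| - |a| ≤ b - a := by
        have := abs_sub_abs_le_abs_sub b a
        rwa [abs_of_pos (sub_pos.2 hab)] at this
      rcases max_cases (0:ℝ) (2 - |a| / 2) with h | h <;>
        rcases max_cases (0:ℝ) (2 - |b| / 2) with h' | h' <;> linarith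
    have hrc : Continuous r := by
      change Continuous fun t : ℝ => t + max 0 (2 - |t| / 2)
      fun_prop
    have hbd : ∀ t, t ≤ r t ∧ r t ≤ t + 2 := by
      intro t
      rw [hr]
      have := abs_nonneg t
      rcases max_cases (0:ℝ) (2 - |t| / 2) with h | h <;> constructor <;> linarith
    have hsurj : Function.Surjective r := by
      apply hrc.surjective
      · exact Filter.tendsto_atTop_mono (fun t => (hbd t).1) Filter.tendsto_id
      · exact Filter.tendsto_atBot_mono (fun t => (hbd t).2)
          (Filter.tendsto_atBot_add_const_right _ 2 Filter.tendsto_id)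
    have hr0 : r 0 = 2 := by rw [hr]; norm_num
    have hout : ∀ t, 4 ≤ |t| → r t = t := by
      intro t ht
      rw [hr, max_eq_left (by linarith), add_zero]
    have hr4 : r 4 = 4 := hout 4 (by norm_num)
    have hr4' : r (-4) = -4 := hout (-4) (by norm_num)
    obtain ⟨τ, hτ, hy⟩ := H x (φ 2 x) (fun t => r t - 2)
      (fun a b hab => sub_lt_sub_right (hmono hab) 2)
      (fun y => by
        obtain ⟨t, ht⟩ := hsurj (y + 2)
        exact ⟨t, by simp only [ht]; ring⟩)
      (by simp only [hr0]; norm_num)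
      (by
        intro t
        rw [← hadd, sub_add_cancel]
        by_cases ht : 4 ≤ |t|
        · rw [hout t ht, dist_self]; exact hδ
        · have ht' := abs_le.1 (not_le.1 ht).le
          have h1 := hx t ⟨ht'.1, ht'.2⟩
          have h2 := hx (r t) ⟨hr4' ▸ hmono.monotone ht'.1,
            (hmono.monotone ht'.2).trans hr4.le⟩
          have h3 := dist_triangle_right (φ t x) (φ (r t) x) p
          linarith)
    rw [abs_lt] at hτ
    have hper : φ (2 - τ) x = x := by
      have : (2:ℝ) - τ = -τ + 2 := by ring
      rw [this, hadd, hy, ← hadd, neg_add_cancel, h0]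
    have hP : Function.Periodic (fun t => φ t x) (2 - τ) := by
      intro t
      simp only [hadd, hper]
    obtain ⟨τ', -, h⟩ := H p x id strictMono_id Function.surjective_id rfl (by
      intro t
      obtain ⟨u, hu, htu⟩ := hP.exists_mem_Ico₀ (by linarith) t
      rw [id, hp, htu, dist_comm]
      have := hx u ⟨by linarith [hu.1], by linarith [hu.2]⟩
      linarith)
    rw [h, hp]
  rw [isOpen_singleton_iff_nhds_eq_pure]
  apply le_antisymm _ (pure_le_nhds p)
  rw [Filter.le_pure_iff]
  exact key
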